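/- arXiv:1910.07795 — 2 statements merged into one kernel-verified Lean document; each statement's English description precedes it below -/
import Mathlib

section
/- Let a ∈ ℝ ∪ {−∞} and let φ : (a,∞) → ℝ be smooth with φ'(t) > 0 and φ''(t) ≥ 0 for all t, and suppose φ has quadratic growth with α = 0 and β > 0, i.e. lim_{t→∞} φ''(t) = 0 and lim_{t→∞} φ'(t) = β. Let r₀ > 0, u₀ ∈ (a,∞) and u₁ ≥ 0 with φ'(u₀)·r₀ ≥ u₁. Then the problem u''(r) = (1 + u'(r)²)·(φ'(u(r)) − u'(r)/r), u(r₀) = u₀, u'(r₀) = u₁ has a unique solution u, it is defined on all of [r₀, ∞), and it is strictly convex. If moreover lim_{t→∞} t·φ''(t) = 0, then lim_{r→∞} r·(u'(r)/φ'(u(r)) − r) = −1/β²; equivalently, u'(r)/φ'(u(r)) = r − 1/(β²·r) + o(1/r) as r → ∞. -/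
open Set Filter
open scoped Topology

lemma s17_nonneg {f f' : ℝ → ℝ} {r₀ : ℝ}
    (hf : ∀ r ∈ Ici r₀, HasDerivWithinAt f (f' r) (Ici r₀) r) (h0 : 0 ≤ f r₀)
    (hb : ∀ r ∈ Ici r₀, f r = 0 → 0 < f' r) : ∀ r ∈ Ici r₀, 0 ≤ f r := by
  intro r hr
  have := @image_le_of_deriv_right_lt_deriv_boundary (fun x => - f x) (fun x => - f' x) r₀ r
    (fun x hx => ((hf x hx.1).continuousWithinAt.mono (fun y hy => hy.1)).neg)
    (fun x hx => ((hf x hx.1).mono (Ici_subset_Ici.2 hx.1)).neg) (fun _ => 0) (fun _ => 0)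
    (by simpa using h0) (fun x => hasDerivAt_const x 0)
    (fun x hx h => by
      have := hb x hx.1 (by simpa using h)
      simpa using this) r ⟨hr, le_rfl⟩
  simpa using this

lemma s17_unique {E : Type*} [NormedAddCommGroup E] [NormedSpace ℝ E]
    {F : ℝ → E → E} {r₀ T : ℝ} {K : NNReal}
    (hK : ∀ t ∈ Icc r₀ T, LipschitzWith K (F t)) {f g : ℝ → E}
    (hf : ∀ r ∈ Icc r₀ T, HasDerivWithinAt f (F r (f r)) (Icc r₀ T) r)
    (hg : ∀ r ∈ Icc r₀ T, HasDerivWithinAt g (F r (g r)) (Icc r₀ T) r)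
    (h : f r₀ = g r₀) : EqOn f g (Icc r₀ T) := by
  refine ODE_solution_unique_of_mem_Icc_right (v := F) (s := fun _ => univ) (K := K)
    (fun t ht => (hK t ⟨ht.1, ht.2.le⟩).lipschitzOnWith)
    (fun r hr => (hf r hr).continuousWithinAt) ?_ (fun _ _ => trivial)
    (fun r hr => (hg r hr).continuousWithinAt) ?_ (fun _ _ => trivial) h
  · intro t ht
    exact (hf t ⟨ht.1, ht.2.le⟩).mono_of_mem_nhdsWithin
      (mem_of_superset (Icc_mem_nhdsGE ht.2) (Icc_subset_Icc_left ht.1))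
  · intro t ht
    exact (hg t ⟨ht.1, ht.2.le⟩).mono_of_mem_nhdsWithin
      (mem_of_superset (Icc_mem_nhdsGE ht.2) (Icc_subset_Icc_left ht.1))

lemma s17_global {E : Type*} [NormedAddCommGroup E] [NormedSpace ℝ E] [CompleteSpace E]
    {F : ℝ → E → E} {r₀ : ℝ} (x₀ : E)
    (hc : ∀ x, ContinuousOn (fun t => F t x) (Ici r₀))
    (hL : ∀ T, r₀ ≤ T → ∃ L K : NNReal, ∀ t ∈ Icc r₀ T, LipschitzWith K (F t) ∧ ∀ x, ‖F t x‖ ≤ L) :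
    ∃ f : ℝ → E, f r₀ = x₀ ∧ ∀ r ∈ Ici r₀, HasDerivWithinAt f (F r (f r)) (Ici r₀) r := by
  have ex : ∀ T : ℝ, ∃ f : ℝ → E, r₀ ≤ T → f r₀ = x₀ ∧
      ∀ r ∈ Icc r₀ T, HasDerivWithinAt f (F r (f r)) (Icc r₀ T) r := by
    intro T
    by_cases hT : r₀ ≤ T
    swap
    · exact ⟨fun _ => x₀, fun h => absurd h hT⟩
    obtain ⟨L, K, h⟩ := hL T hT
    have hpl : IsPicardLindelof F (⟨r₀, left_mem_Icc.2 hT⟩ : Icc r₀ T) x₀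
        (L * (T - r₀).toNNReal) 0 L K := by
      refine ⟨fun t ht => (h t ht).1.lipschitzOnWith, fun x _ => (hc x).mono (fun y hy => hy.1),
        fun t ht x _ => (h t ht).2 x, ?_⟩
      simp [hT]
    obtain ⟨f, h1, h2⟩ := hpl.exists_eq_forall_mem_Icc_hasDerivWithinAt₀
    exact ⟨f, fun _ => ⟨h1, h2⟩⟩
  choose f hf using ex
  have agree : ∀ S T, r₀ ≤ S → S ≤ T → EqOn (f S) (f T) (Icc r₀ S) := by
    intro S T hS hST
    obtain ⟨L, K, h⟩ := hL S hS
    refine s17_unique (fun t ht => (h t ht).1) (hf S hS).2 ?_ ?_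
    · intro r hr
      exact ((hf T (hS.trans hST)).2 r ⟨hr.1, hr.2.trans hST⟩).mono (Icc_subset_Icc_right hST)
    · rw [(hf S hS).1, (hf T (hS.trans hST)).1]
  refine ⟨fun r => f (r + 1) r, ?_, ?_⟩
  · exact (hf (r₀ + 1) (by linarith)).1
  · intro r hr
    have hr' : r₀ ≤ r := hr
    have h1 := (hf (r + 1) (by linarith)).2 r ⟨hr, by linarith⟩
    have h2 : HasDerivWithinAt (f (r + 1)) (F r (f (r + 1) r)) (Ici r₀) r := by
      refine h1.mono_of_mem_nhdsWithin ?_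
      rw [mem_nhdsWithin]
      exact ⟨Iio (r + 1), isOpen_Iio, by simp, fun y hy => ⟨hy.2, hy.1.le⟩⟩
    refine h2.congr_of_eventuallyEq ?_ rfl
    have : Iio (r + 1) ∩ Ici r₀ ∈ 𝓝[Ici r₀] r :=
      inter_mem (mem_nhdsWithin_of_mem_nhds (Iio_mem_nhds (by linarith))) self_mem_nhdsWithin
    filter_upwards [this] with y hy
    have hy1 : y < r + 1 := hy.1
    have hy2 : r₀ ≤ y := hy.2
    rcases le_total (y + 1) (r + 1) with h | h
    · exact agree _ _ (by linarith) h ⟨hy2, by linarith⟩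
    · exact (agree _ _ (by linarith) h ⟨hy2, hy1.le⟩).symm

/-- the clipped slope -/
noncomputable def s17c (β r p : ℝ) : ℝ := max 0 (min p (β * r))

lemma s17c_lip (β r p q : ℝ) : |s17c β r p - s17c β r q| ≤ |p - q| := by
  have : LipschitzWith 1 (s17c β r) := (LipschitzWith.id.min_const (β * r)).const_max 0
  simpa [Real.dist_eq] using this.dist_le_mul p q

/-- the truncated field -/
noncomputable def s17F (β u₀ : ℝ) (g : ℝ → ℝ) (r : ℝ) (x : ℝ × ℝ) : ℝ × ℝ :=
  (s17c β r x.2, (1 + s17c β r x.2 ^ 2) * (g (max x.1 u₀) - s17c β r x.2 / r))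

lemma s17_est {M β r₀ r c d G H : ℝ} (hr₀ : 0 < r₀) (hr : r₀ ≤ r) (_hβ : 0 < β) (hM : 0 ≤ M)
    (hc : 0 ≤ c) (hcM : c ≤ M) (hd : 0 ≤ d) (hdM : d ≤ M) (hG : 0 ≤ G) (hGβ : G ≤ β) :
    |(1 + c ^ 2) * (G - c / r) - (1 + d ^ 2) * (H - d / r)| ≤
      |c - d| * (2 * M * (β + M / r₀) + (1 + M ^ 2) / r₀) + (1 + M ^ 2) * |G - H| := by
  have hrp : 0 < r := by linarith
  have e : (1 + c ^ 2) * (G - c / r) - (1 + d ^ 2) * (H - d / r) =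
    (c - d) * ((c + d) * (G - c / r) - (1 + d ^ 2) / r) + (1 + d ^ 2) * (G - H) := by
    field_simp; ring
  rw [e]
  refine (abs_add_le _ _).trans (add_le_add ?_ ?_)
  · rw [abs_mul]
    refine mul_le_mul_of_nonneg_left ?_ (abs_nonneg _)
    refine (abs_sub _ _).trans (add_le_add ?_ ?_)
    · rw [abs_mul]
      refine mul_le_mul ?_ ?_ (abs_nonneg _) (by positivity)
      · rw [abs_of_nonneg (by positivity)]; linarith
      · refine (abs_sub _ _).trans (add_le_add ?_ ?_)
        · rw [abs_of_nonneg hG]; exact hGβ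
        · rw [abs_of_nonneg (by positivity)]; gcongr
    · rw [abs_of_nonneg (by positivity)]; gcongr
  · rw [abs_mul, abs_of_nonneg (by positivity : (0:ℝ) ≤ 1 + d ^ 2)]; gcongr

lemma s17_field {β u₀ r₀ : ℝ} {g : ℝ → ℝ} {k : NNReal} (hr₀ : 0 < r₀) (hβ : 0 < β)
    (hg0 : ∀ t, u₀ ≤ t → 0 ≤ g t) (hgβ : ∀ t, u₀ ≤ t → g t ≤ β)
    (hk : LipschitzOnWith k g (Ici u₀)) (T : ℝ) (hT : r₀ ≤ T) :
    ∃ L K : NNReal, ∀ t ∈ Icc r₀ T, LipschitzWith K (s17F β u₀ g t) ∧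
      ∀ x, ‖s17F β u₀ g t x‖ ≤ L := by
  set M := β * T with hMdef
  have hM : 0 ≤ M := by have : 0 < T := by linarith
                        positivity
  have hc0 : ∀ t p, 0 ≤ s17c β t p := fun t p => le_max_left _ _
  have hcM : ∀ t ∈ Icc r₀ T, ∀ p, s17c β t p ≤ M := by
    intro t ht p
    refine max_le hM ((min_le_right _ _).trans ?_)
    exact mul_le_mul_of_nonneg_left ht.2 hβ.le
  set C := 2 * M * (β + M / r₀) + (1 + M ^ 2) / r₀ with hC
  have hC0 : 0 ≤ C := by positivity
  refine ⟨(M + (1 + M ^ 2) * (β + M / r₀)).toNNReal, (1 + C + (1 + M ^ 2) * k).toNNReal,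
    fun t ht => ⟨?_, ?_⟩⟩
  · refine LipschitzWith.of_dist_le_mul fun x y => ?_
    rw [Real.coe_toNNReal _ (by positivity)]
    have hx1 : |x.1 - y.1| ≤ dist x y := by rw [Prod.dist_eq]; exact le_max_left _ _
    have hx2 : |x.2 - y.2| ≤ dist x y := by rw [Prod.dist_eq]; exact le_max_right _ _
    have h1 := (s17c_lip β t x.2 y.2).trans hx2
    have hGH : |g (max x.1 u₀) - g (max y.1 u₀)| ≤ k * dist x y := by
      have := hk.dist_le_mul _ (le_max_right x.1 u₀) _ (le_max_right y.1 u₀)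
      rw [Real.dist_eq, Real.dist_eq] at this
      refine this.trans (mul_le_mul_of_nonneg_left ?_ k.2)
      refine le_trans ?_ hx1
      simpa using abs_max_sub_max_le_max x.1 u₀ y.1 u₀
    have hd0 : 0 ≤ dist x y := dist_nonneg
    have hk0 : (0:ℝ) ≤ k := k.2
    rw [Prod.dist_eq]
    refine max_le ?_ ?_
    · rw [Real.dist_eq]
      refine h1.trans ?_
      have : 0 ≤ C + (1 + M ^ 2) * k := by positivity
      nlinarith
    · rw [Real.dist_eq]
      refine (s17_est (H := g (max y.1 u₀)) hr₀ ht.1 hβ hM (hc0 _ _) (hcM t ht _) (hc0 _ _)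
        (hcM t ht _) (hg0 _ (le_max_right x.1 u₀)) (hgβ _ (le_max_right x.1 u₀))).trans ?_
      have e1 : |s17c β t x.2 - s17c β t y.2| * C ≤ dist x y * C :=
        mul_le_mul_of_nonneg_right h1 hC0
      have e2 : (1 + M ^ 2) * |g (max x.1 u₀) - g (max y.1 u₀)| ≤ (1 + M ^ 2) * (k * dist x y) :=
        mul_le_mul_of_nonneg_left hGH (by positivity)
      nlinarith
  · intro x
    have htp : 0 < t := lt_of_lt_of_le hr₀ ht.1
    have hg1 := hg0 _ (le_max_right x.1 u₀)
    have hg2 := hgβ _ (le_max_right x.1 u₀)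
    rw [Real.coe_toNNReal _ (by positivity), Prod.norm_def]
    have hp : 0 ≤ (1 + M ^ 2) * (β + M / r₀) := by positivity
    refine max_le ?_ ?_
    · simp only [s17F]
      rw [Real.norm_eq_abs, abs_of_nonneg (hc0 _ _)]
      have := hcM t ht x.2
      linarith
    · simp only [s17F]
      rw [Real.norm_eq_abs, abs_mul, abs_of_nonneg (by positivity : (0:ℝ) ≤ 1 + s17c β t x.2 ^ 2)]
      have h1 := hcM t ht x.2
      have h0 := hc0 t x.2
      have : (1 + s17c β t x.2 ^ 2) * |g (max x.1 u₀) - s17c β t x.2 / t| ≤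
          (1 + M ^ 2) * (β + M / r₀) := by
        refine mul_le_mul (by gcongr) ?_ (abs_nonneg _) (by positivity)
        refine (abs_sub _ _).trans (add_le_add ?_ ?_)
        · rw [abs_of_nonneg hg1]; exact hg2
        · rw [abs_of_nonneg (by positivity)]; have := ht.1; gcongr
      linarith

lemma s17_field_cont {β u₀ r₀ : ℝ} {g : ℝ → ℝ} (hr₀ : 0 < r₀) (x : ℝ × ℝ) :
    ContinuousOn (fun t => s17F β u₀ g t x) (Ici r₀) := by
  have hc : Continuous (fun t => s17c β t x.2) := by unfold s17c; fun_prop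
  unfold s17F
  refine hc.continuousOn.prodMk ?_
  refine ContinuousOn.mul (by fun_prop) (continuousOn_const.sub ?_)
  exact hc.continuousOn.div continuousOn_id (fun t ht => (lt_of_lt_of_le hr₀ ht).ne')

lemma s17_mono {f f' : ℝ → ℝ} {r₀ : ℝ}
    (hf : ∀ r ∈ Ici r₀, HasDerivWithinAt f (f' r) (Ici r₀) r)
    (hb : ∀ r ∈ Ici r₀, 0 ≤ f' r) : MonotoneOn f (Ici r₀) := by
  refine monotoneOn_of_hasDerivWithinAt_nonneg (f' := f') (convex_Ici _)
    (fun r hr => (hf r hr).continuousWithinAt) ?_ ?_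
  · intro x hx
    exact (hf x (interior_subset hx)).mono interior_subset
  · intro x hx
    exact hb x (interior_subset hx)

lemma s17_w_deriv {g g1 u p : ℝ → ℝ} {r₀ r : ℝ}
    (hu : HasDerivWithinAt u (p r) (Ici r₀) r)
    (hp : HasDerivWithinAt p ((1 + p r ^ 2) * (g (u r) - p r / r)) (Ici r₀) r)
    (hg : HasDerivAt g (g1 (u r)) (u r)) :
    HasDerivWithinAt (fun r => r * g (u r) - p r)
      (g (u r) + r * (g1 (u r) * p r) - (1 + p r ^ 2) * (g (u r) - p r / r)) (Ici r₀) r := by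
  have h1 : HasDerivWithinAt (fun r => g (u r)) (g1 (u r) * p r) (Ici r₀) r :=
    hg.comp_hasDerivWithinAt r hu
  have h2 := ((hasDerivWithinAt_id r (Ici r₀)).mul h1).sub hp
  exact HasDerivWithinAt.congr_deriv h2 (by simp)

lemma s17_props {g g1 u p : ℝ → ℝ} {r₀ u₀ u₁ : ℝ} (hr₀ : 0 < r₀)
    (hg : ∀ t, u₀ ≤ t → HasDerivAt g (g1 t) t) (hg1 : ∀ t, u₀ ≤ t → 0 ≤ g1 t)
    (hpos : ∀ r ∈ Ici r₀, 0 < g (u r))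
    (hu0 : u r₀ = u₀) (hp0 : p r₀ = u₁) (hu₁ : 0 ≤ u₁) (hs : u₁ ≤ g u₀ * r₀)
    (hu : ∀ r ∈ Ici r₀, HasDerivWithinAt u (p r) (Ici r₀) r)
    (hp : ∀ r ∈ Ici r₀,
      HasDerivWithinAt p ((1 + p r ^ 2) * (g (u r) - p r / r)) (Ici r₀) r) :
    (∀ r ∈ Ici r₀, 0 ≤ p r) ∧ (∀ r ∈ Ici r₀, u₀ ≤ u r) ∧ (∀ r ∈ Ici r₀, p r ≤ r * g (u r)) ∧
    (∀ r ∈ Ioi r₀, p r < r * g (u r)) := by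
  have hp' : ∀ r ∈ Ici r₀, 0 ≤ p r := by
    refine s17_nonneg hp (by rw [hp0]; exact hu₁) ?_
    intro r hr h
    have := hpos r hr
    simp [h, this]
  have hu' : ∀ r ∈ Ici r₀, u₀ ≤ u r := by
    intro r hr
    rw [← hu0]
    exact s17_mono hu hp' self_mem_Ici hr hr
  have hd := fun r (hr : r ∈ Ici r₀) => s17_w_deriv (g1 := g1) (hu r hr) (hp r hr) (hg _ (hu' r hr))
  have key : ∀ r ∈ Ici r₀, r * g (u r) - p r = 0 →
      0 < g (u r) + r * (g1 (u r) * p r) - (1 + p r ^ 2) * (g (u r) - p r / r) := by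
    intro r hr h
    have hr' : 0 < r := lt_of_lt_of_le hr₀ hr
    have e : g (u r) - p r / r = 0 := by
      field_simp; linarith
    rw [e]
    have h1 := hpos r hr
    have h2 := hp' r hr
    have h3 := hg1 _ (hu' r hr)
    have : 0 ≤ r * (g1 (u r) * p r) := by positivity
    linarith
  have hw := s17_nonneg hd (by simp only [hu0, hp0]; linarith) key
  refine ⟨hp', hu', fun r hr => by have := hw r hr; linarith, fun r hr => ?_⟩
  have hr1 : r₀ < r := hr
  by_contra hcon
  have hw0 : r * g (u r) - p r = 0 := by have := hw r hr1.le; linarith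
  have hmin : IsLocalMin (fun r => r * g (u r) - p r) r := by
    filter_upwards [Ici_mem_nhds hr1] with y hy
    rw [hw0]; exact hw y hy
  have := hmin.hasDerivAt_eq_zero ((hd r hr1.le).hasDerivAt (Ici_mem_nhds hr1))
  have := key r hr1.le hw0
  linarith

lemma s17_conv_upper {f K k : ℝ → ℝ} {R c L : ℝ} (hc : 0 < c)
    (hf : ∀ r, R ≤ r → HasDerivAt f (K r * (k r - f r)) r) (hK : ∀ r, R ≤ r → c ≤ K r)
    (hk : Tendsto k atTop (𝓝 L)) (ε : ℝ) (hε : 0 < ε) : ∀ᶠ r in atTop, f r < L + ε := by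
  have h1 : ∀ᶠ r in atTop, k r < L + ε / 2 := hk.eventually_lt_const (by linarith)
  obtain ⟨R1, hR1⟩ := eventually_atTop.1 h1
  set S := max R R1 with hS
  set C := |f S - L| with hC
  have hC0 : 0 ≤ C := abs_nonneg _
  have hlim : Tendsto (fun r => L + ε / 2 + C * Real.exp (-(c * (r - S)))) atTop
      (𝓝 (L + ε / 2 + C * 0)) := by
    refine tendsto_const_nhds.add (tendsto_const_nhds.mul ?_)
    refine Real.tendsto_exp_neg_atTop_nhds_zero.comp ?_
    exact (tendsto_atTop_add_const_right _ (-S) tendsto_id).const_mul_atTop hc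
  have hev : ∀ᶠ r in atTop, L + ε / 2 + C * Real.exp (-(c * (r - S))) < L + ε :=
    hlim.eventually_lt_const (by linarith)
  filter_upwards [hev, eventually_ge_atTop S] with r hr hrS
  refine lt_of_le_of_lt ?_ hr
  have hB : ∀ x, HasDerivAt (fun r => L + ε / 2 + C * Real.exp (-(c * (r - S))))
      (C * (Real.exp (-(c * (x - S))) * (-c))) x := by
    intro x
    have h0 : HasDerivAt (fun r => -(c * (r - S))) (-c) x := by
      exact HasDerivAt.congr_deriv (((hasDerivAt_id x).sub_const S).const_mul c).neg (by simp)
    exact (h0.exp.const_mul C).const_add _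
  have hRS : R ≤ S := le_max_left _ _
  refine image_le_of_deriv_right_lt_deriv_boundary (f' := fun r => K r * (k r - f r))
    (a := S) (b := r)
    (fun x hx => (hf x (hRS.trans hx.1)).continuousAt.continuousWithinAt)
    (fun x hx => (hf x (hRS.trans hx.1)).hasDerivWithinAt) ?_ hB ?_ ⟨hrS, le_rfl⟩
  · simp only [sub_self, mul_zero, neg_zero, Real.exp_zero, mul_one]
    have := le_abs_self (f S - L)
    linarith
  · intro x hx he
    have hk' := hR1 x ((le_max_right _ _).trans hx.1)
    have hK' := hK x (hRS.trans hx.1)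
    set E := Real.exp (-(c * (x - S))) with hE
    have hE0 : 0 < E := Real.exp_pos _
    have hCE : 0 ≤ C * E := by positivity
    have h2 : k x - f x < - (C * E) := by rw [he]; linarith
    nlinarith

lemma s17_conv {f K k : ℝ → ℝ} {R c L : ℝ} (hc : 0 < c)
    (hf : ∀ r, R ≤ r → HasDerivAt f (K r * (k r - f r)) r) (hK : ∀ r, R ≤ r → c ≤ K r)
    (hk : Tendsto k atTop (𝓝 L)) : Tendsto f atTop (𝓝 L) := by
  rw [Metric.tendsto_nhds]
  intro ε hε
  have h1 := s17_conv_upper hc hf hK hk ε hε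
  have h2 := s17_conv_upper (f := fun r => - f r) (K := K) (k := fun r => - k r) (L := -L) hc
    (fun r hr => by
      have := (hf r hr).neg
      exact HasDerivAt.congr_deriv this (by ring)) hK hk.neg ε hε
  filter_upwards [h1, h2] with r a b
  rw [Real.dist_eq, abs_lt]
  constructor <;> linarith

lemma s17_asymp {g g1 u p : ℝ → ℝ} {r₀ u₀ β : ℝ} (hr₀ : 0 < r₀) (hβ : 0 < β)
    (hg : ∀ t, u₀ ≤ t → HasDerivAt g (g1 t) t) (hg1 : ∀ t, u₀ ≤ t → 0 ≤ g1 t)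
    (hg0 : 0 < g u₀) (hgu : ∀ t, u₀ ≤ t → g u₀ ≤ g t) (hgβ : ∀ t, u₀ ≤ t → g t ≤ β)
    (hlim : Tendsto g atTop (𝓝 β)) (hlim1 : Tendsto (fun t => t * g1 t) atTop (𝓝 0))
    (hu : ∀ r ∈ Ici r₀, HasDerivWithinAt u (p r) (Ici r₀) r)
    (hp : ∀ r ∈ Ici r₀,
      HasDerivWithinAt p ((1 + p r ^ 2) * (g (u r) - p r / r)) (Ici r₀) r)
    (hp0 : ∀ r ∈ Ici r₀, 0 ≤ p r) (huu : ∀ r ∈ Ici r₀, u₀ ≤ u r)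
    (hple : ∀ r ∈ Ici r₀, p r ≤ r * g (u r)) (hplt : ∀ r ∈ Ioi r₀, p r < r * g (u r)) :
    Tendsto (fun r => r * (p r / g (u r) - r)) atTop (𝓝 (-(1 / β ^ 2))) := by
  -- positivity of `p`
  have hpm : MonotoneOn p (Ici r₀) := by
    refine s17_mono hp fun r hr => ?_
    have hr' : 0 < r := lt_of_lt_of_le hr₀ hr
    have h1 := hple r hr
    have : 0 ≤ g (u r) - p r / r := by rw [sub_nonneg, div_le_iff₀ hr']; linarith
    positivity
  have hpp : ∀ r ∈ Ioi r₀, 0 < p r := by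
    intro r hr
    have hr1 : r₀ < r := hr
    have hr' : 0 < r := hr₀.trans hr1
    rcases (hp0 r hr1.le).lt_or_eq with h | h
    · exact h
    · exfalso
      have hmin : IsLocalMin p r := by
        filter_upwards [Ici_mem_nhds hr1] with y hy
        rw [← h]; exact hp0 y hy
      have h2 := hmin.hasDerivAt_eq_zero ((hp r hr1.le).hasDerivAt (Ici_mem_nhds hr1))
      rw [← h] at h2
      have := hgu _ (huu r hr1.le)
      simp at h2
      linarith
  set r₁ := r₀ + 1 with hr₁
  have h01 : r₀ < r₁ := by linarith
  have hr1p : 0 < r₁ := by linarith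
  have hud : ∀ r, r₁ ≤ r → HasDerivAt u (p r) r := fun r hr =>
    (hu r (h01.le.trans hr)).hasDerivAt (Ici_mem_nhds (by linarith))
  have hpd : ∀ r, r₁ ≤ r → HasDerivAt p ((1 + p r ^ 2) * (g (u r) - p r / r)) r := fun r hr =>
    (hp r (h01.le.trans hr)).hasDerivAt (Ici_mem_nhds (by linarith))
  have hsd : ∀ r, r₁ ≤ r → HasDerivAt (fun r => p r / r)
      (((1 + p r ^ 2) * (g (u r) - p r / r) * r - p r * 1) / r ^ 2) r := fun r hr =>
    (hpd r hr).div (hasDerivAt_id r) (by simp; linarith)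
  -- linear lower bound
  obtain ⟨m, hm0, hmg, hm1⟩ : ∃ m, 0 < m ∧ m ≤ g u₀ / 2 ∧ m ≤ p r₁ / r₁ :=
    ⟨min (g u₀ / 2) (p r₁ / r₁), lt_min (by linarith) (div_pos (hpp _ h01) hr1p),
      min_le_left _ _, min_le_right _ _⟩
  have hlow : ∀ r, r₁ ≤ r → m ≤ p r / r := by
    intro r hr
    have := s17_nonneg (f := fun r => p r / r - m) (r₀ := r₁)
      (fun r hr => ((hsd r hr).sub_const m).hasDerivWithinAt) (by linarith) ?_ r hr
    · linarith
    · intro r hr h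
      have hrr : r₁ ≤ r := hr
      have hr' : 0 < r := by linarith
      have h1 : p r / r = m := by linarith
      have h2 : p r = m * r := by rw [← h1]; field_simp
      have h3 := hgu _ (huu r (h01.le.trans hrr))
      rw [h1, h2]
      apply div_pos _ (by positivity)
      have h5 : m ≤ g (u r) - m := by linarith
      have h4 : (1 + (m * r) ^ 2) * m ≤ (1 + (m * r) ^ 2) * (g (u r) - m) :=
        mul_le_mul_of_nonneg_left h5 (by positivity)
      have h6 : 0 < (m * r) ^ 2 * m * r := by positivity
      nlinarith
  have hlow' : ∀ r, r₁ ≤ r → m * r ≤ p r := by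
    intro r hr
    have := hlow r hr
    rwa [le_div_iff₀ (by linarith)] at this
  -- quadratic lower bound for `u`
  have hquad : ∀ r, r₁ ≤ r → u r₁ - m / 2 * r₁ ^ 2 ≤ u r - m / 2 * r ^ 2 := by
    intro r hr
    refine s17_mono (f := fun r => u r - m / 2 * r ^ 2) (f' := fun r => p r - m * r) (r₀ := r₁)
      ?_ ?_ self_mem_Ici hr hr
    · intro r hr
      have := (hud r hr).sub ((hasDerivAt_pow 2 r).const_mul (m / 2))
      refine HasDerivAt.hasDerivWithinAt ?_
      exact HasDerivAt.congr_deriv this (by simp; ring)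
    · intro r hr
      have := hlow' r hr
      linarith
  have hsq : Tendsto (fun r : ℝ => m / 4 * r ^ 2) atTop atTop :=
    (tendsto_pow_atTop two_ne_zero).const_mul_atTop (by positivity)
  have hu4 : ∀ᶠ r in atTop, m / 4 * r ^ 2 ≤ u r := by
    filter_upwards [hsq.eventually_ge_atTop (-(u r₁ - m / 2 * r₁ ^ 2)), eventually_ge_atTop r₁]
      with r h1 h2
    have := hquad r h2
    linarith
  have huT : Tendsto u atTop atTop := tendsto_atTop_mono' _ hu4 hsq
  have hgT : Tendsto (fun r => g (u r)) atTop (𝓝 β) := hlim.comp huT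
  have hpT : Tendsto p atTop atTop := by
    refine tendsto_atTop_mono' _ ?_ (tendsto_id.const_mul_atTop hm0)
    filter_upwards [eventually_ge_atTop r₁] with r hr using hlow' r hr
  have hK : ∀ r, r₁ ≤ r → m ^ 2 * r₁ ≤ p r ^ 2 / r := by
    intro r hr
    have hr' : 0 < r := by linarith
    have := hlow' r hr
    rw [le_div_iff₀ hr']
    have h1 : (m * r) ^ 2 ≤ p r ^ 2 := by gcongr
    have h2 : m ^ 2 * r₁ * r ≤ m ^ 2 * r * r := by gcongr
    nlinarith
  -- `p / r → β`
  have hsT : Tendsto (fun r => p r / r) atTop (𝓝 β) := by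
    refine s17_conv (R := r₁) (c := m ^ 2 * r₁) (K := fun r => (1 + p r ^ 2) / r)
      (k := fun r => g (u r) - p r / r / (1 + p r ^ 2)) (by positivity) ?_ ?_ ?_
    · intro r hr
      have hr' : 0 < r := by linarith
      have := hsd r hr
      convert this using 1
      have : 1 + p r ^ 2 ≠ 0 := by positivity
      field_simp
      ring
    · intro r hr
      have hr' : 0 < r := by linarith
      refine (hK r hr).trans ?_
      gcongr; linarith
    · have h1 : Tendsto (fun r => p r / r / (1 + p r ^ 2)) atTop (𝓝 0) := by
        have h2 : Tendsto (fun r => β / (1 + p r ^ 2)) atTop (𝓝 0) := by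
          refine Tendsto.const_div_atTop ?_ β
          exact tendsto_atTop_add_const_left _ _ ((tendsto_pow_atTop two_ne_zero).comp hpT)
        refine tendsto_of_tendsto_of_tendsto_of_le_of_le' tendsto_const_nhds h2 ?_ ?_
        · filter_upwards [eventually_ge_atTop r₁] with r hr
          have := hlow r hr
          have : 0 ≤ p r / r := by linarith
          positivity
        · filter_upwards [eventually_ge_atTop r₁] with r hr
          have hr' : 0 < r := by linarith
          have h3 := hple r (h01.le.trans hr)
          have h4 := hgβ _ (huu r (h01.le.trans hr))
          have : p r / r ≤ β := by rw [div_le_iff₀ hr']; nlinarith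
          gcongr
      simpa using hgT.sub h1
  have hg1T : Tendsto (fun r => r ^ 2 * g1 (u r)) atTop (𝓝 0) := by
    have h2 : Tendsto (fun r => 4 / m * (u r * g1 (u r))) atTop (𝓝 (4 / m * 0)) :=
      (hlim1.comp huT).const_mul _
    rw [mul_zero] at h2
    refine tendsto_of_tendsto_of_tendsto_of_le_of_le' tendsto_const_nhds h2 ?_ ?_
    · filter_upwards [eventually_ge_atTop r₁] with r hr
      have := hg1 _ (huu r (h01.le.trans hr))
      positivity
    · filter_upwards [eventually_ge_atTop r₁, hu4] with r hr h4
      have := hg1 _ (huu r (h01.le.trans hr))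
      have h5 : r ^ 2 ≤ 4 / m * u r := by
        rw [div_mul_eq_mul_div, le_div_iff₀ hm0]; linarith
      calc r ^ 2 * g1 (u r) ≤ 4 / m * u r * g1 (u r) := by gcongr
        _ = _ := by ring
  have hzT : Tendsto (fun r => r * (r * g (u r) - p r)) atTop (𝓝 (β / β ^ 2 + 0 / β)) := by
    refine s17_conv (R := r₁) (c := m ^ 2 * r₁) (K := fun r => p r ^ 2 / r)
      (k := fun r => g (u r) / (p r / r) ^ 2 + r ^ 2 * g1 (u r) / (p r / r)) (by positivity) ?_ hK ?_
    · intro r hr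
      have hr' : 0 < r := by linarith
      have hpr : 0 < p r := hpp r (by simp; linarith)
      have hw := (s17_w_deriv (g1 := g1) (hu r (h01.le.trans hr)) (hp r (h01.le.trans hr))
        (hg _ (huu r (h01.le.trans hr)))).hasDerivAt (Ici_mem_nhds (by linarith))
      have := (hasDerivAt_id r).mul hw
      refine HasDerivAt.congr_deriv this ?_
      simp only [id]
      field_simp
      ring
    · exact (hgT.div (hsT.pow 2) (by positivity)).add (hg1T.div hsT hβ.ne')
  have hfin := (hzT.div hgT hβ.ne').neg
  have e : -((β / β ^ 2 + 0 / β) / β) = -(1 / β ^ 2) := by field_simp; ring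
  rw [e] at hfin
  refine hfin.congr' ?_
  filter_upwards [eventually_ge_atTop r₁] with r hr
  have h3 := hgu _ (huu r (h01.le.trans hr))
  have h4 : g (u r) ≠ 0 := by linarith
  simp only [Pi.div_apply]
  change -(r * (r * g (u r) - p r) / g (u r)) = r * (p r / g (u r) - r)
  field_simp
  ring


/-- (Asymptotic behaviour, case `α = 0`.) Let `φ` be smooth on
`(a,∞)` with `φ' > 0`, `φ'' ≥ 0`, `φ''(t) → 0` and `φ'(t) → β > 0`.  If `r₀ > 0`,
`u₀ ∈ (a,∞)`, `0 ≤ u₁` and `φ'(u₀)·r₀ ≥ u₁`, then the problem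
`u'' = (1 + u'²)(φ'(u) - u'/r)`, `u(r₀) = u₀`, `u'(r₀) = u₁` has a unique solution,
defined and strictly convex on all of `[r₀,∞)`; if moreover `t·φ''(t) → 0` then
`u'(r)/φ'(u(r)) = r - 1/(β² r) + o(1/r)` as `r → ∞`. -/
theorem stmt_17 (a : EReal) (β : ℝ) (hβ : 0 < β) (φ φ' φ'' : ℝ → ℝ)
    (hφsm : ContDiffOn ℝ (⊤ : ℕ∞) φ {t : ℝ | a < (t : EReal)})
    (hφd : ∀ t : ℝ, a < (t : EReal) → HasDerivAt φ (φ' t) t)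
    (hφd2 : ∀ t : ℝ, a < (t : EReal) → HasDerivAt φ' (φ'' t) t)
    (hφ'pos : ∀ t : ℝ, a < (t : EReal) → 0 < φ' t)
    (hφ''nn : ∀ t : ℝ, a < (t : EReal) → 0 ≤ φ'' t)
    (hquad1 : Tendsto φ'' atTop (𝓝 (0 : ℝ)))
    (hquad2 : Tendsto φ' atTop (𝓝 β))
    (r₀ : ℝ) (hr₀ : 0 < r₀)
    (u₀ : ℝ) (hu₀ : a < (u₀ : EReal))
    (u₁ : ℝ) (hu₁ : 0 ≤ u₁) (hslope : u₁ ≤ φ' u₀ * r₀) :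
    ∃ u u' : ℝ → ℝ,
      (∀ r ∈ Ici r₀, a < (u r : EReal)) ∧
      u r₀ = u₀ ∧ u' r₀ = u₁ ∧
      (∀ r ∈ Ici r₀, HasDerivWithinAt u (u' r) (Ici r₀) r) ∧
      (∀ r ∈ Ici r₀,
        HasDerivWithinAt u' ((1 + u' r ^ 2) * (φ' (u r) - u' r / r)) (Ici r₀) r) ∧
      -- strict convexity
      StrictConvexOn ℝ (Ici r₀) u ∧
      -- uniqueness
      (∀ v v' : ℝ → ℝ,
        (∀ r ∈ Ici r₀, a < (v r : EReal)) →
        v r₀ = u₀ → v' r₀ = u₁ →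
        (∀ r ∈ Ici r₀, HasDerivWithinAt v (v' r) (Ici r₀) r) →
        (∀ r ∈ Ici r₀,
          HasDerivWithinAt v' ((1 + v' r ^ 2) * (φ' (v r) - v' r / r)) (Ici r₀) r) →
        ∀ r ∈ Ici r₀, v r = u r) ∧
      -- asymptotic expansion under the extra hypothesis `t·φ''(t) → 0`
      (Tendsto (fun t : ℝ => t * φ'' t) atTop (𝓝 (0 : ℝ)) →
        Tendsto (fun r => r * (u' r / φ' (u r) - r)) atTop (𝓝 (-(1 / β ^ 2)))) := by
  set U : Set ℝ := {t : ℝ | a < (t : EReal)} with hU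
  have hUo : IsOpen U := isOpen_Ioi.preimage continuous_coe_real_ereal
  have hup : ∀ t, u₀ ≤ t → t ∈ U := fun t ht => lt_of_lt_of_le hu₀ (EReal.coe_le_coe_iff.2 ht)
  -- regularity
  have hc1 : ContDiffOn ℝ (⊤ : ℕ∞) φ' U :=
    ((contDiffOn_infty_iff_deriv_of_isOpen hUo).1 hφsm).2.congr
      (fun t ht => (hφd t ht).deriv.symm)
  have hc2 : ContinuousOn φ'' U :=
    ((contDiffOn_infty_iff_deriv_of_isOpen hUo).1 hc1).2.continuousOn.congr
      (fun t ht => (hφd2 t ht).deriv.symm)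
  have hmono : MonotoneOn φ' (Ici u₀) :=
    s17_mono (fun r hr => (hφd2 r (hup r hr)).hasDerivWithinAt) (fun r hr => hφ''nn r (hup r hr))
  have hgβ : ∀ t, u₀ ≤ t → φ' t ≤ β := by
    intro t ht
    refine ge_of_tendsto hquad2 ?_
    filter_upwards [eventually_ge_atTop t] with s hs
    exact hmono ht (ht.trans hs) hs
  have hgu : ∀ t, u₀ ≤ t → φ' u₀ ≤ φ' t := fun t ht => hmono self_mem_Ici ht ht
  have hg0 : ∀ t, u₀ ≤ t → 0 ≤ φ' t := fun t ht => (hφ'pos t (hup t ht)).le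
  obtain ⟨k, hk⟩ : ∃ k : NNReal, LipschitzOnWith k φ' (Ici u₀) := by
    obtain ⟨S, hS⟩ := eventually_atTop.1 (hquad1.eventually_lt_const (zero_lt_one))
    obtain ⟨C, hC⟩ := (isCompact_Icc (a := u₀) (b := S)).exists_bound_of_continuousOn
      (hc2.mono (fun t ht => hup t ht.1))
    refine ⟨(max C 1).toNNReal, ?_⟩
    refine (convex_Ici u₀).lipschitzOnWith_of_nnnorm_hasDerivWithin_le (f' := φ'')
      (fun t ht => (hφd2 t (hup t ht)).hasDerivWithinAt) ?_
    intro t ht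
    rw [← NNReal.coe_le_coe, coe_nnnorm, Real.coe_toNNReal _ (le_max_of_le_right zero_le_one)]
    rcases le_total t S with h | h
    · exact (hC t ⟨ht, h⟩).trans (le_max_left _ _)
    · rw [Real.norm_eq_abs, abs_of_nonneg (hφ''nn t (hup t ht))]
      exact (hS t h).le.trans (le_max_right _ _)
  have hfield := s17_field (u₀ := u₀) (g := φ') (k := k) hr₀ hβ hg0 hgβ hk
  obtain ⟨f, hf0, hf⟩ := s17_global (F := s17F β u₀ φ') (r₀ := r₀) (u₀, u₁)
    (s17_field_cont hr₀) hfield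
  have hd1 : ∀ r ∈ Ici r₀, HasDerivWithinAt (fun r => (f r).1) (s17F β u₀ φ' r (f r)).1
      (Ici r₀) r := fun r hr => (hf r hr).fst
  have hd2 : ∀ r ∈ Ici r₀, HasDerivWithinAt (fun r => (f r).2) (s17F β u₀ φ' r (f r)).2
      (Ici r₀) r := fun r hr => (hf r hr).snd
  have hu00 : (f r₀).1 = u₀ := by rw [hf0]
  have hu10 : (f r₀).2 = u₁ := by rw [hf0]
  have hup1 : ∀ r ∈ Ici r₀, u₀ ≤ (f r).1 := by
    intro r hr
    have := s17_mono hd1 (fun r _ => le_max_left _ _) self_mem_Ici hr hr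
    simp only [hu00] at this
    exact this
  have hp0 : ∀ r ∈ Ici r₀, 0 ≤ (f r).2 := by
    refine s17_nonneg hd2 (by simp only [hu10]; exact hu₁) ?_
    intro r hr h
    have hr' : 0 < r := lt_of_lt_of_le hr₀ hr
    have hc : s17c β r (f r).2 = 0 := by
      rw [s17c, h]
      exact max_eq_left (min_le_left _ _)
    have := hφ'pos _ (hup _ (le_max_right (f r).1 u₀))
    simp [s17F, hc, this]
  have hpβ : ∀ r ∈ Ici r₀, (f r).2 ≤ β * r := by
    intro r hr
    have := s17_nonneg (f := fun r => β * r - (f r).2) (r₀ := r₀)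
      (fun r hr => (((hasDerivWithinAt_id r (Ici r₀)).const_mul β).sub (hd2 r hr))) ?_ ?_ r hr
    · linarith
    · simp only [hu10]
      have := hgβ u₀ le_rfl
      nlinarith
    · intro r hr h
      have hr' : 0 < r := lt_of_lt_of_le hr₀ hr
      have h' : (f r).2 = β * r := by linarith
      have hc : s17c β r (f r).2 = β * r := by
        rw [s17c, h', min_self]
        exact max_eq_right (by positivity)
      have h1 := hgβ _ (le_max_right (f r).1 u₀)
      simp only [s17F, hc]
      have e : β * r / r = β := by field_simp
      rw [e]
      have : (1 + (β * r) ^ 2) * (φ' (max (f r).1 u₀) - β) ≤ 0 :=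
        mul_nonpos_of_nonneg_of_nonpos (by positivity) (by linarith)
      linarith
  -- the truncated field agrees with the true one in the relevant region
  have hagree : ∀ r x y, 0 ≤ y → y ≤ β * r → u₀ ≤ x →
      s17F β u₀ φ' r (x, y) = (y, (1 + y ^ 2) * (φ' x - y / r)) := by
    intro r x y h1 h2 h3
    simp only [s17F, s17c, min_eq_left h2, max_eq_right h1, max_eq_left h3]
  have hag : ∀ r ∈ Ici r₀, s17F β u₀ φ' r (f r) =
      ((f r).2, (1 + (f r).2 ^ 2) * (φ' (f r).1 - (f r).2 / r)) :=
    fun r hr => hagree r (f r).1 (f r).2 (hp0 r hr) (hpβ r hr) (hup1 r hr)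
  have hud : ∀ r ∈ Ici r₀, HasDerivWithinAt (fun r => (f r).1) (f r).2 (Ici r₀) r := by
    intro r hr
    have := hd1 r hr
    rwa [hag r hr] at this
  have hpd : ∀ r ∈ Ici r₀, HasDerivWithinAt (fun r => (f r).2)
      ((1 + (f r).2 ^ 2) * (φ' (f r).1 - (f r).2 / r)) (Ici r₀) r := by
    intro r hr
    have := hd2 r hr
    rwa [hag r hr] at this
  have hgd : ∀ t, u₀ ≤ t → HasDerivAt φ' (φ'' t) t := fun t ht => hφd2 t (hup t ht)
  have hgn : ∀ t, u₀ ≤ t → 0 ≤ φ'' t := fun t ht => hφ''nn t (hup t ht)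
  obtain ⟨-, -, q3, q4⟩ := s17_props (u := fun r => (f r).1) (p := fun r => (f r).2) hr₀ hgd hgn
    (fun r hr => hφ'pos _ (hup _ (hup1 r hr))) hu00 hu10 hu₁ hslope hud hpd
  refine ⟨fun r => (f r).1, fun r => (f r).2, fun r hr => hup _ (hup1 r hr), hu00, hu10, hud, hpd,
    ?_, ?_, ?_⟩
  · have hpc : StrictMonoOn (fun r => (f r).2) (Ici r₀) := by
      refine strictMonoOn_of_deriv_pos (convex_Ici _) (fun r hr => (hpd r hr).continuousWithinAt) ?_
      intro r hr
      rw [interior_Ici] at hr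
      have hr1 : r₀ < r := hr
      have hr' : 0 < r := hr₀.trans hr1
      rw [((hpd r hr1.le).hasDerivAt (Ici_mem_nhds hr1)).deriv]
      have h1 := q4 r hr
      have : 0 < φ' (f r).1 - (f r).2 / r := by
        rw [sub_pos, div_lt_iff₀ hr']
        linarith
      positivity
    refine StrictMonoOn.strictConvexOn_of_deriv (convex_Ici _)
      (fun r hr => (hud r hr).continuousWithinAt) ?_
    refine (hpc.mono interior_subset).congr ?_
    intro r hr
    rw [interior_Ici] at hr
    have hr1 : r₀ < r := hr
    exact ((hud r hr1.le).hasDerivAt (Ici_mem_nhds hr1)).deriv.symm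
  · intro v v' hva hv0 hv1 hvd hvd' r hr
    obtain ⟨w1, w2, w3, -⟩ := s17_props hr₀ hgd hgn
      (fun r hr => hφ'pos _ (hva r hr)) hv0 hv1 hu₁ hslope hvd hvd'
    obtain ⟨L, K, hLK⟩ := hfield r hr
    have hsub : Icc r₀ r ⊆ Ici r₀ := fun y hy => hy.1
    have := s17_unique (F := s17F β u₀ φ') (f := fun r => (v r, v' r)) (g := f)
      (fun t ht => (hLK t ht).1) ?_ (fun t ht => (hf t ht.1).mono hsub) ?_ ⟨hr, le_rfl⟩
    · exact congrArg Prod.fst this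
    · intro t ht
      have h3 : v' t ≤ β * t := by
        have h4 := w3 t ht.1
        have h5 := hgβ _ (w2 t ht.1)
        have : 0 < t := lt_of_lt_of_le hr₀ ht.1
        nlinarith
      rw [hagree t (v t) (v' t) (w1 t ht.1) h3 (w2 t ht.1)]
      exact ((hvd t ht.1).prodMk (hvd' t ht.1)).mono hsub
    · simp only [hv0, hv1, hf0]
  · intro hlim1
    exact s17_asymp (u := fun r => (f r).1) (p := fun r => (f r).2) hr₀ hβ hgd hgn
      (hφ'pos _ hu₀) hgu hgβ hquad2 hlim1 hud hpd hp0 hup1 q3 q4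
end

section
/- Let a ∈ ℝ ∪ {−∞} and let φ : (a,∞) → ℝ be smooth with φ'(t) > 0 and φ''(t) ≥ 0 for all t. Suppose there are α > 0, β ∈ ℝ and a real sequence (aₙ)_{n≥1} such that for all sufficiently large t, φ'(t) = α·t + β + Σ_{n≥1} aₙ·t^{−n}, where the power series Σ aₙ·wⁿ converges on a neighborhood of w = 0 (i.e. w ↦ φ'(1/w) − α/w − β is real-analytic at 0 and vanishes there), and assume either all aₙ vanish or the first non-vanishing aₖ is positive. Let r₀ > 0, u₀ ∈ (a,∞), 0 ≤ u₁ ≤ r₀·φ'(u₀), and let u : [r₀,∞) → (a,∞) be the solution of u''(r) = (1 + u'(r)²)·(φ'(u(r)) − u'(r)/r) with u(r₀) = u₀, u'(r₀) = u₁. Then there exist a constant C > 0, M > 0 and r₁ ≥ r₀ such that |φ(u(r)) − C·e^{α·r²}| ≤ M·r² for all r ≥ r₁; that is, φ(u(r)) = C·e^{α r²} + O(r²) as r → ∞. -/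
open Set Filter
open scoped Topology

lemma aux_barrier (r₀ : ℝ) (f f' : ℝ → ℝ)
    (hf : ∀ r ∈ Ici r₀, HasDerivWithinAt f (f' r) (Ici r₀) r) (h0 : 0 ≤ f r₀)
    (h : ∀ r ∈ Ici r₀, f r = 0 → 0 < f' r) : ∀ r ∈ Ici r₀, 0 ≤ f r := by
  intro r hr
  have key := image_le_of_deriv_right_lt_deriv_boundary (f := fun x => - f x)
    (f' := fun x => - f' x) (a := r₀) (b := r) (B := fun _ => 0) (B' := fun _ => 0)
    (fun x hx => ((hf x hx.1).neg.continuousWithinAt).mono Icc_subset_Ici_self)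
    (fun x hx => (hf x hx.1).neg.mono (Ici_subset_Ici.2 hx.1))
    (by simpa using h0) (fun x => hasDerivAt_const x 0)
    (fun x hx hx0 => by
      have := h x hx.1 (by simpa using hx0)
      simpa using this)
  have := key (right_mem_Icc.2 hr)
  simpa using this

lemma aux_mono (r₀ : ℝ) (f f' : ℝ → ℝ)
    (hf : ∀ r ∈ Ici r₀, HasDerivWithinAt f (f' r) (Ici r₀) r)
    (h : ∀ r ∈ Ici r₀, 0 ≤ f' r) : MonotoneOn f (Ici r₀) := by
  apply monotoneOn_of_hasDerivWithinAt_nonneg (convex_Ici r₀) (f' := f')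
    (fun x hx => (hf x hx).continuousWithinAt)
  · intro x hx
    exact (hf x (interior_subset hx)).mono interior_subset
  · intro x hx
    exact h x (interior_subset hx)

lemma aux_series (cs : ℕ → ℝ) (hcs0 : cs 0 = 0) (ε : ℝ)
    (hsum : ∀ w : ℝ, |w| < ε → Summable (fun n => cs n * w ^ n))
    (T : ℝ) (hT0 : 0 < T) (hTε : T⁻¹ < ε) :
    ∃ K : ℝ, 0 < K ∧ ∀ t : ℝ, T ≤ t → |∑' n, cs n * (t⁻¹) ^ n| ≤ K / t := by
  have hs := (hsum T⁻¹ (by rwa [abs_of_pos (inv_pos.2 hT0)])).abs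
  have hS : 0 ≤ ∑' n, |cs n * T⁻¹ ^ n| := tsum_nonneg fun n => abs_nonneg _
  refine ⟨T * (∑' n, |cs n * T⁻¹ ^ n|) + 1, by positivity, fun t ht => ?_⟩
  have ht0 : 0 < t := hT0.trans_le ht
  have hle : ∀ n, |cs n * t⁻¹ ^ n| ≤ (T / t) * |cs n * T⁻¹ ^ n| := by
    intro n
    cases n with
    | zero => simp [hcs0]
    | succ n =>
      rw [abs_mul, abs_mul, abs_of_pos (by positivity : 0 < t⁻¹ ^ (n+1)),
        abs_of_pos (by positivity : 0 < T⁻¹ ^ (n+1))]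
      have h1 : t⁻¹ ^ n ≤ T⁻¹ ^ n := by gcongr
      have h2 : T / t * (|cs (n+1)| * T⁻¹ ^ (n+1)) = |cs (n+1)| * (T⁻¹ ^ n * t⁻¹) := by
        rw [pow_succ]; field_simp
      rw [h2, pow_succ]
      gcongr
  have hs2 : Summable (fun n => (T / t) * |cs n * T⁻¹ ^ n|) := hs.mul_left _
  have hs1 : Summable (fun n => |cs n * t⁻¹ ^ n|) :=
    Summable.of_nonneg_of_le (fun n => abs_nonneg _) hle hs2
  have h1 : |∑' n, cs n * (t⁻¹) ^ n| ≤ ∑' n, |cs n * t⁻¹ ^ n| := by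
    have := norm_tsum_le_tsum_norm (f := fun n => cs n * t⁻¹ ^ n) (by simpa using hs1)
    simpa [Real.norm_eq_abs] using this
  have h2 := hs1.tsum_le_tsum hle hs2
  rw [tsum_mul_left] at h2
  have h3 : T / t * ∑' n, |cs n * T⁻¹ ^ n| ≤ (T * (∑' n, |cs n * T⁻¹ ^ n|) + 1) / t := by
    rw [div_mul_eq_mul_div]
    gcongr
    linarith
  linarith

/-- Linear comparison: `y' = 2αr y + O(r)` with `y` unbounded gives `y = C e^{αr²} + O(1)`. -/
lemma aux_lin (α : ℝ) (hα : 0 < α) (r₂ : ℝ) (hr₂ : 0 < r₂) (y y' : ℝ → ℝ) (M : ℝ) (hM : 0 < M)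
    (hy : ∀ r ∈ Ici r₂, HasDerivWithinAt y (y' r) (Ici r₂) r)
    (hb : ∀ r ∈ Ici r₂, |y' r - 2 * α * r * y r| ≤ M * r)
    (hub : ∀ X : ℝ, ∃ r ∈ Ici r₂, X < y r) :
    ∃ C : ℝ, 0 < C ∧ ∀ r ∈ Ici r₂, |y r - C * Real.exp (α * r ^ 2)| ≤ M / (2 * α) := by
  set N := M / (2 * α) with hN
  have hNpos : 0 < N := by positivity
  have hNM : N * (2 * α) = M := by rw [hN]; field_simp
  have hE : ∀ r : ℝ, HasDerivAt (fun r => Real.exp (-(α * r ^ 2)))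
      (Real.exp (-(α * r ^ 2)) * (-(α * (2 * r)))) r := by
    intro r
    have := (((hasDerivAt_id r).pow 2).const_mul α).neg.exp
    simpa using this
  have hlo : MonotoneOn (fun r => (y r - N) * Real.exp (-(α * r ^ 2))) (Ici r₂) := by
    apply aux_mono r₂ _ _ (fun r hr => ((hy r hr).sub_const N).mul (hE r).hasDerivWithinAt)
    intro r hr
    have h1 := abs_le.1 (hb r hr)
    have h2 := Real.exp_pos (-(α * r ^ 2))
    have : 0 ≤ Real.exp (-(α * r ^ 2)) * (y' r - 2 * α * r * y r + N * (2 * α) * r) := by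
      apply mul_nonneg h2.le; rw [hNM]; linarith
    linarith
  have hhi : MonotoneOn (fun r => -((y r + N) * Real.exp (-(α * r ^ 2)))) (Ici r₂) := by
    apply aux_mono r₂ _ _ (fun r hr => (((hy r hr).add_const N).mul (hE r).hasDerivWithinAt).neg)
    intro r hr
    have h1 := abs_le.1 (hb r hr)
    have h2 := Real.exp_pos (-(α * r ^ 2))
    have : 0 ≤ Real.exp (-(α * r ^ 2)) * (-(y' r - 2 * α * r * y r) + N * (2 * α) * r) := by
      apply mul_nonneg h2.le; rw [hNM]; linarith
    linarith
  set L := fun r => (y r - N) * Real.exp (-(α * r ^ 2)) with hL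
  set H := fun r => (y r + N) * Real.exp (-(α * r ^ 2)) with hH
  have hLH : ∀ s ∈ Ici r₂, ∀ r ∈ Ici r₂, L s ≤ H r := by
    intro s hs r hr
    have hm : max s r ∈ Ici r₂ := mem_Ici.2 (le_trans (mem_Ici.1 hs) (le_max_left _ _))
    have a1 : L s ≤ L (max s r) := hlo hs hm (le_max_left _ _)
    have a2 : -H r ≤ -H (max s r) := hhi hr hm (le_max_right _ _)
    have a3 : L (max s r) ≤ H (max s r) := by
      simp only [hL, hH]; gcongr; linarith
    linarith
  have hne : (L '' Ici r₂).Nonempty := ⟨L r₂, mem_image_of_mem _ self_mem_Ici⟩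
  have hbdd : BddAbove (L '' Ici r₂) := by
    refine ⟨H r₂, ?_⟩
    rintro _ ⟨s, hs, rfl⟩
    exact hLH s hs r₂ self_mem_Ici
  set C := sSup (L '' Ici r₂) with hC
  have hbound : ∀ r ∈ Ici r₂, |y r - C * Real.exp (α * r ^ 2)| ≤ N := by
    intro r hr
    have h1 : L r ≤ C := le_csSup hbdd (mem_image_of_mem _ hr)
    have h2 : C ≤ H r := by
      apply csSup_le hne
      rintro _ ⟨s, hs, rfl⟩
      exact hLH s hs r hr
    have hp := Real.exp_pos (α * r ^ 2)
    have hq : Real.exp (-(α * r ^ 2)) * Real.exp (α * r ^ 2) = 1 := by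
      rw [← Real.exp_add]; simp
    have h1' := mul_le_mul_of_nonneg_right h1 hp.le
    have h2' := mul_le_mul_of_nonneg_right h2 hp.le
    simp only [hL, hH, mul_assoc, hq, mul_one] at h1' h2'
    rw [abs_le]; constructor <;> linarith
  refine ⟨C, ?_, hbound⟩
  by_contra hCn
  push Not at hCn
  obtain ⟨r, hr, hX⟩ := hub N
  have h1 := (abs_le.1 (hbound r hr)).2
  have := mul_nonneg (neg_nonneg.2 hCn) (Real.exp_pos (α * r ^ 2)).le
  linarith

set_option maxHeartbeats 2000000 in
/-- Suppose `φ' > 0`, `φ'' ≥ 0` on `(a,∞)` and, for large `t`,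
`φ'(t) = α t + β + Σ_{n≥1} aₙ t⁻ⁿ` (a convergent power series in `t⁻¹`, with either all
`aₙ = 0` or the first non-vanishing coefficient positive), with `α > 0`.  Then any
solution `u` of the rotational `[φ,e₃]`-minimal equation on `[r₀,∞)` with
`u(r₀) = u₀`, `u'(r₀) = u₁`, `0 ≤ u₁ ≤ r₀·φ'(u₀)` satisfies
`φ(u(r)) = C·e^{α r²} + O(r²)` as `r → ∞` for some constant `C > 0`. -/
theorem stmt_18 (a : EReal) (α β : ℝ) (hα : 0 < α) (φ φ' φ'' : ℝ → ℝ)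
    (hφsm : ContDiffOn ℝ (⊤ : ℕ∞) φ {t : ℝ | a < (t : EReal)})
    (hφd : ∀ t : ℝ, a < (t : EReal) → HasDerivAt φ (φ' t) t)
    (hφd2 : ∀ t : ℝ, a < (t : EReal) → HasDerivAt φ' (φ'' t) t)
    (hφ'pos : ∀ t : ℝ, a < (t : EReal) → 0 < φ' t)
    (hφ''nn : ∀ t : ℝ, a < (t : EReal) → 0 ≤ φ'' t)
    -- the expansion `φ'(t) = α t + β + Σ_{n ≥ 1} aₙ t⁻ⁿ` for large `t`
    (cs : ℕ → ℝ) (hcs0 : cs 0 = 0)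
    (ε : ℝ) (hε : 0 < ε)
    (hsum : ∀ w : ℝ, |w| < ε → Summable (fun n => cs n * w ^ n))
    (T : ℝ) (hT0 : 0 < T) (hTa : a < (T : EReal)) (hTε : T⁻¹ < ε)
    (hexp : ∀ t : ℝ, T ≤ t → φ' t = α * t + β + ∑' n, cs n * (t⁻¹) ^ n)
    -- either all coefficients vanish or the first non-vanishing one is positive
    (hsign : (∀ n, cs n = 0) ∨ ∃ k, 0 < cs k ∧ ∀ m < k, cs m = 0)
    -- the solution
    (r₀ : ℝ) (hr₀ : 0 < r₀)
    (u₀ : ℝ) (hu₀ : a < (u₀ : EReal))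
    (u₁ : ℝ) (hu₁ : 0 ≤ u₁) (hslope : u₁ ≤ r₀ * φ' u₀)
    (u u' : ℝ → ℝ)
    (hmem : ∀ r ∈ Ici r₀, a < (u r : EReal))
    (h0 : u r₀ = u₀) (h0' : u' r₀ = u₁)
    (hd : ∀ r ∈ Ici r₀, HasDerivWithinAt u (u' r) (Ici r₀) r)
    (hd2 : ∀ r ∈ Ici r₀,
      HasDerivWithinAt u' ((1 + u' r ^ 2) * (φ' (u r) - u' r / r)) (Ici r₀) r) :
    ∃ C M r₁ : ℝ, 0 < C ∧ 0 < M ∧ r₀ ≤ r₁ ∧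
      ∀ r : ℝ, r₁ ≤ r → |φ (u r) - C * Real.exp (α * r ^ 2)| ≤ M * r ^ 2 := by
  obtain ⟨K, hK, hKb⟩ := aux_series cs hcs0 ε hsum T hT0 hTε
  have hφb : ∀ t : ℝ, T ≤ t → |φ' t - α * t - β| ≤ K / t := by
    intro t ht
    have := hKb t ht
    rw [hexp t ht]
    convert this using 2
    ring
  clear hexp hKb hsum hsign
  -- u' ≥ 0
  have hu'nn : ∀ r ∈ Ici r₀, 0 ≤ u' r := by
    apply aux_barrier r₀ u' _ hd2 (by rw [h0']; exact hu₁)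
    intro r hr h
    have := hφ'pos _ (hmem r hr)
    rw [h]; simpa using this
  have hφu : ∀ r ∈ Ici r₀, HasDerivWithinAt (fun r => φ' (u r)) (φ'' (u r) * u' r) (Ici r₀) r :=
    fun r hr => (hφd2 _ (hmem r hr)).comp_hasDerivWithinAt r (hd r hr)
  have hrpos : ∀ r ∈ Ici r₀, 0 < r := fun r hr => hr₀.trans_le hr
  -- g ≥ 0
  have hg : ∀ r ∈ Ici r₀, 0 ≤ r * φ' (u r) - u' r := by
    apply aux_barrier r₀ (fun r => r * φ' (u r) - u' r) _
      (fun r hr => ((hasDerivWithinAt_id r _).mul (hφu r hr)).sub (hd2 r hr))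
    · simp only [h0, h0']; linarith
    · intro r hr h
      have hr0 := hrpos r hr
      have h1 := hφ'pos _ (hmem r hr)
      have h2 : φ' (u r) - u' r / r = 0 := by field_simp; linarith
      have h3 := mul_nonneg (mul_nonneg hr0.le (hφ''nn _ (hmem r hr))) (hu'nn r hr)
      rw [h2]
      try simp only [id]
      linarith
  have hφmono : MonotoneOn (fun r => φ' (u r)) (Ici r₀) :=
    aux_mono r₀ _ _ hφu (fun r hr => mul_nonneg (hφ''nn _ (hmem r hr)) (hu'nn r hr))
  have hp : 0 < φ' u₀ := hφ'pos _ hu₀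
  have hφlow : ∀ r ∈ Ici r₀, φ' u₀ ≤ φ' (u r) := by
    intro r hr
    have := hφmono (self_mem_Ici) hr hr
    simpa [h0] using this
  obtain ⟨c, hc⟩ : ∃ c, c = φ' u₀ / 3 := ⟨_, rfl⟩
  have hcpos : 0 < c := by rw [hc]; positivity
  have hu'low : ∀ r ∈ Ici r₀, 0 ≤ u' r - c * (r - r₀) := by
    apply aux_barrier r₀ (fun r => u' r - c * (r - r₀)) _
      (fun r hr => (hd2 r hr).sub (((hasDerivWithinAt_id r _).sub_const r₀).const_mul c))
    · simp only [h0']; linarith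
    · intro r hr h
      have hr0 := hrpos r hr
      have h1 := hφlow r hr
      have h2 : u' r / r ≤ c := by
        rw [div_le_iff₀ hr0]; nlinarith
      have h3 : 2 * c ≤ φ' (u r) - u' r / r := by linarith
      nlinarith [sq_nonneg (u' r), mul_nonneg (sq_nonneg (u' r)) (by linarith : 0 ≤ φ' (u r) - u' r / r)]
  have humono : MonotoneOn u (Ici r₀) := aux_mono r₀ u u' hd hu'nn
  have hulow : MonotoneOn (fun r => u r - c / 2 * (r - r₀) ^ 2) (Ici r₀) := by
    apply aux_mono r₀ _ _
      (fun r hr => (hd r hr).sub ((((hasDerivWithinAt_id r _).sub_const r₀).pow 2).const_mul (c / 2)))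
    intro r hr
    have := hu'low r hr
    simp only [id]
    norm_num
    linarith
  have hulim : ∀ X : ℝ, ∃ R : ℝ, r₀ + 1 ≤ R ∧ ∀ r, R ≤ r → X ≤ u r := by
    intro X
    have hq : 0 ≤ 2 * |X - u₀| / c := by positivity
    refine ⟨r₀ + 1 + 2 * |X - u₀| / c, by linarith, fun r hr => ?_⟩
    have h1 := hulow self_mem_Ici (show r ∈ Ici r₀ by simp only [mem_Ici]; linarith)
      (by linarith)
    simp only [h0, sub_self] at h1
    have h2 : 2 * |X - u₀| / c ≤ r - r₀ := by linarith
    rw [div_le_iff₀ hcpos] at h2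
    have h3 : (r - r₀) ≤ (r - r₀) ^ 2 := by nlinarith
    have h4 := le_abs_self (X - u₀)
    nlinarith
  -- first threshold
  obtain ⟨r₁, hr₁, hr₁u⟩ := hulim (max T (max 1 (max (4 / α) (2 * (|β| + K) / α))))
  have hU : ∀ r ∈ Ici r₁, T ≤ u r ∧ 1 ≤ u r ∧ 4 ≤ α * u r ∧ 2 * (|β| + K) ≤ α * u r := by
    intro r hr
    have := hr₁u r hr
    simp only [max_le_iff] at this
    obtain ⟨h1, h2, h3, h4⟩ := this
    rw [div_le_iff₀ hα] at h3 h4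
    exact ⟨h1, h2, by linarith, by linarith⟩
  have hsub1 : Ici r₁ ⊆ Ici r₀ := Ici_subset_Ici.2 (by linarith)
  have hφ2 : ∀ r ∈ Ici r₁, α * u r / 2 ≤ φ' (u r) ∧ φ' (u r) ≤ 2 * α * u r := by
    intro r hr
    obtain ⟨h1, h2, h3, h4⟩ := hU r hr
    have h5 := abs_le.1 (hφb _ h1)
    have h6 : K / u r ≤ K := div_le_self hK.le h2
    have h7 := neg_abs_le β
    have h8 := le_abs_self β
    constructor <;> linarith
  have hu'pos1 : 0 < u' r₁ := by
    have := hu'low r₁ (hsub1 self_mem_Ici)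
    have : 0 < c * (r₁ - r₀) := mul_pos hcpos (by linarith)
    linarith
  have hr₁pos : 0 < r₁ := by linarith
  have hu1pos : 0 < u r₁ := by linarith [(hU r₁ self_mem_Ici).2.1]
  obtain ⟨k, hk⟩ : ∃ k, k = min (α / 8) (u' r₁ / (r₁ * u r₁)) := ⟨_, rfl⟩
  have hkpos : 0 < k := by rw [hk]; exact lt_min (by positivity) (by positivity)
  have hkα : k ≤ α / 8 := by rw [hk]; exact min_le_left _ _
  have hk1 : k * (r₁ * u r₁) ≤ u' r₁ := by
    rw [← le_div_iff₀ (by positivity), hk]; exact min_le_right _ _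
  have hkru : ∀ r ∈ Ici r₁, 0 ≤ u' r - k * (r * u r) := by
    apply aux_barrier r₁ (fun r => u' r - k * (r * u r)) _
      (fun r hr => ((hd2 r (hsub1 hr)).mono hsub1).sub
        (((hasDerivWithinAt_id r _).mul ((hd r (hsub1 hr)).mono hsub1)).const_mul k))
    · linarith
    · intro r hr h
      have hr0 := hrpos r (hsub1 hr)
      obtain ⟨h1, h2, h3, h4⟩ := hU r hr
      have h5 := (hφ2 r hr).1
      have h6 : u' r = k * (r * u r) := by linarith
      have h7 : u' r / r = k * u r := by rw [h6]; field_simp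
      rw [h7]
      try simp only [id]
      have hupos : 0 < u r := by linarith
      have h8 : 3 * α / 8 * u r ≤ φ' (u r) - k * u r := by nlinarith
      have h9 : k * u r < 3 * α / 8 * u r := by
        apply mul_lt_mul_of_pos_right _ hupos; linarith
      have h10 : 1 ≤ 3 * α / 8 * u r := by linarith
      have h11 : (1 + u' r ^ 2) * (3 * α / 8 * u r) ≤ (1 + u' r ^ 2) * (φ' (u r) - k * u r) := by
        gcongr
      have h12 : u' r ^ 2 * 1 ≤ u' r ^ 2 * (3 * α / 8 * u r) := by gcongr
      have h13 : k * (r * u' r) ≤ u' r ^ 2 := by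
        have : 0 ≤ k * r * u' r * (u r - 1) :=
          mul_nonneg (mul_nonneg (by positivity) (hu'nn r (hsub1 hr))) (by linarith)
        have e : u' r ^ 2 = (k * (r * u r)) * u' r := by rw [← h6]; ring
        rw [e]; linarith
      linarith
  -- second threshold
  obtain ⟨R₂, hR₂, hR₂u⟩ := hulim (4 * α / k ^ 2)
  obtain ⟨r₂, hr₂⟩ : ∃ r₂, r₂ = max (max r₁ R₂) 1 := ⟨_, rfl⟩
  have hr₂1 : r₁ ≤ r₂ := by rw [hr₂]; exact le_trans (le_max_left _ _) (le_max_left _ _)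
  have hr₂2 : R₂ ≤ r₂ := by rw [hr₂]; exact le_trans (le_max_right _ _) (le_max_left _ _)
  have hr₂3 : 1 ≤ r₂ := by rw [hr₂]; exact le_max_right _ _
  have hr₂pos : 0 < r₂ := by linarith
  have hsub2 : Ici r₂ ⊆ Ici r₁ := Ici_subset_Ici.2 hr₂1
  have hsub20 : Ici r₂ ⊆ Ici r₀ := hsub2.trans hsub1
  have hud : ∀ r ∈ Ici r₂, HasDerivWithinAt u (u' r) (Ici r₂) r :=
    fun r hr => (hd r (hsub20 hr)).mono hsub20
  have hku : ∀ r ∈ Ici r₂, 4 * α ≤ k ^ 2 * u r := by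
    intro r hr
    have := hR₂u r (hr₂2.trans hr)
    rw [div_le_iff₀ (by positivity)] at this
    linarith
  have hupos2 : ∀ r ∈ Ici r₂, 0 < u r := fun r hr => by linarith [(hU r (hsub2 hr)).2.1]
  have hu'up : ∀ r ∈ Ici r₂, u' r ≤ r * (2 * α * u r) := by
    intro r hr
    have h1 := hg r (hsub20 hr)
    have h2 := mul_le_mul_of_nonneg_left (hφ2 r (hsub2 hr)).2 (hrpos r (hsub20 hr)).le
    linarith
  obtain ⟨D, hD⟩ : ∃ D, D = max (2 * (K * k ^ 2 + α + |β| + 2 * α ^ 2 + 1) / k ^ 2)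
    ((r₂ * (α * u r₂ + β) - u' r₂) * u r₂ / r₂) := ⟨_, rfl⟩
  have hD1 : 2 * (K * k ^ 2 + α + |β| + 2 * α ^ 2 + 1) ≤ D * k ^ 2 := by
    rw [← div_le_iff₀ (by positivity), hD]; exact le_max_left _ _
  have hD2 : (r₂ * (α * u r₂ + β) - u' r₂) * u r₂ ≤ D * r₂ := by
    rw [← div_le_iff₀ (by positivity), hD]; exact le_max_right _ _
  have hDpos : 0 < D := by
    have : 0 < D * k ^ 2 := lt_of_lt_of_le (by positivity) hD1
    exact pos_of_mul_pos_left this (by positivity)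
  have hDK : K ≤ D := by
    have : K * k ^ 2 ≤ D * k ^ 2 := by
      have := abs_nonneg β
      have : 0 < K * k ^ 2 := by positivity
      nlinarith [sq_nonneg α]
    exact le_of_mul_le_mul_right this (by positivity)
  have hh : ∀ r ∈ Ici r₂, 0 ≤ D * (r / u r) - (r * (α * u r + β) - u' r) := by
    apply aux_barrier r₂ (fun r => D * (r / u r) - (r * (α * u r + β) - u' r)) _
      (fun r hr => (((hasDerivWithinAt_id r _).div (hud r hr) (hupos2 r hr).ne').const_mul D).sub
        (((hasDerivWithinAt_id r _).mul (((hud r hr).const_mul α).add_const β)).sub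
        ((hd2 r (hsub20 hr)).mono hsub20)))
    · rw [sub_nonneg, ← mul_div_assoc, le_div_iff₀ (hupos2 r₂ self_mem_Ici)]
      exact hD2
    · intro r hr h
      obtain ⟨h1, h2, h3, h4⟩ := hU r (hsub2 hr)
      have hr1 : 1 ≤ r := hr₂3.trans hr
      have hr0 : 0 < r := by linarith
      have hupos := hupos2 r hr
      have hup := hu'up r hr
      have hun := hu'nn r (hsub20 hr)
      have hlo := hkru r (hsub2 hr)
      have hku' := hku r hr
      have he := (abs_le.1 (hφb _ h1)).1
      try simp only [id]
      -- lower bound for the bracket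
      have b1 : (D - K) / u r ≤ φ' (u r) - u' r / r := by
        have : u' r / r = α * u r + β - D / u r := by
          have : u' r = r * (α * u r + β) - D * (r / u r) := by linarith
          rw [this]; field_simp
        rw [this, sub_div]; linarith
      have b2 : (k * (r * u r)) ^ 2 ≤ 1 + u' r ^ 2 := by
        have : (k * (r * u r)) ^ 2 ≤ u' r ^ 2 := by
          apply pow_le_pow_left₀ (by positivity); linarith
        linarith
      have b3 : (k * (r * u r)) ^ 2 * ((D - K) / u r) ≤
          (1 + u' r ^ 2) * (φ' (u r) - u' r / r) := by
        apply mul_le_mul b2 b1 (div_nonneg (by linarith) hupos.le) (by positivity)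
      have b4 : (k * (r * u r)) ^ 2 * ((D - K) / u r) = k ^ 2 * r ^ 2 * u r * (D - K) := by
        field_simp
      rw [b4] at b3
      -- derivative of the barrier
      have b5 : -(D * (2 * α * r ^ 2)) ≤ D * ((1 * u r - r * u' r) / u r ^ 2) := by
        have : -(2 * α * r ^ 2) ≤ (1 * u r - r * u' r) / u r ^ 2 := by
          rw [le_div_iff₀ (by positivity)]
          have q1 : r * u' r ≤ r * (r * (2 * α * u r)) := by gcongr
          have q2 : 0 ≤ 2 * α * r ^ 2 * u r * (u r - 1) :=
            mul_nonneg (by positivity) (by linarith)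
          linarith
        have := mul_le_mul_of_nonneg_left this hDpos.le
        linarith
      have b6 : r * (α * u' r) ≤ 2 * α ^ 2 * r ^ 2 * u r := by
        have : r * (α * u' r) ≤ r * (α * (r * (2 * α * u r))) := by gcongr
        linarith
      have b7 : 4 * α * (r ^ 2 * D) ≤ k ^ 2 * u r * (r ^ 2 * D) := by gcongr
      have b8 : 2 * (K * k ^ 2 + α + |β| + 2 * α ^ 2 + 1) * (r ^ 2 * u r) ≤
          D * k ^ 2 * (r ^ 2 * u r) := by gcongr
      have hr2 : 1 ≤ r ^ 2 := one_le_pow₀ hr1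
      have b9 : u r ≤ r ^ 2 * u r := le_mul_of_one_le_left hupos.le hr2
      have b10 : α * u r ≤ α * (r ^ 2 * u r) := by gcongr
      have b11 : |β| * 1 ≤ |β| * (r ^ 2 * u r) := by gcongr; linarith
      have b12 := le_abs_self β
      have b13 : 0 < r ^ 2 * u r := by positivity
      linarith
  -- final asymptotics
  have hFd : ∀ r ∈ Ici r₂, HasDerivWithinAt (fun r => φ (u r) - α / 2 * (u r + β / α) ^ 2)
      ((φ' (u r) - α * u r - β) * u' r) (Ici r₂) r := by
    intro r hr
    have h1 := ((hφd _ (hmem r (hsub20 hr))).comp_hasDerivWithinAt r (hud r hr)).sub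
      ((((hud r hr).add_const (β / α)).pow 2).const_mul (α / 2))
    refine HasDerivWithinAt.congr_deriv h1 ?_
    have e : α * (β / α) = β := by field_simp
    push_cast
    norm_num only [pow_one]
    linear_combination (- u' r) * e
  have hFb : ∀ r ∈ Ici r₂, |(φ' (u r) - α * u r - β) * u' r| ≤ 2 * K * α * r := by
    intro r hr
    have hun := hu'nn r (hsub20 hr)
    have hupos := hupos2 r hr
    rw [abs_mul, abs_of_nonneg hun]
    calc _ ≤ K / u r * (r * (2 * α * u r)) :=
          mul_le_mul (hφb _ (hU r (hsub2 hr)).1) (hu'up r hr) hun (by positivity)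
      _ = _ := by field_simp
  have hsq : ∀ r : ℝ, HasDerivWithinAt (fun r : ℝ => K * α * r ^ 2) (2 * K * α * r) (Ici r₂) r := by
    intro r
    refine HasDerivWithinAt.congr_deriv
      (((hasDerivWithinAt_id r (Ici r₂)).pow 2).const_mul (K * α)) ?_
    simp; ring
  have hF1 := aux_mono r₂ _ _ (fun r hr => (hsq r).add (hFd r hr))
    (fun r hr => by linarith [(abs_le.1 (hFb r hr)).1])
  have hF2 := aux_mono r₂ _ _ (fun r hr => (hsq r).sub (hFd r hr))
    (fun r hr => by linarith [(abs_le.1 (hFb r hr)).2])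
  obtain ⟨F, hF⟩ : ∃ F : ℝ → ℝ, F = fun r => φ (u r) - α / 2 * (u r + β / α) ^ 2 := ⟨_, rfl⟩
  have hFbound : ∀ r ∈ Ici r₂, |F r| ≤ K * α * r ^ 2 + |F r₂| := by
    intro r hr
    have h1 := hF1 self_mem_Ici hr hr
    have h2 := hF2 self_mem_Ici hr hr
    try simp only [Pi.add_apply, Pi.sub_apply] at h1 h2
    have e1 : F r = φ (u r) - α / 2 * (u r + β / α) ^ 2 := by rw [hF]
    have e2 : F r₂ = φ (u r₂) - α / 2 * (u r₂ + β / α) ^ 2 := by rw [hF]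
    rw [← e1, ← e2] at h1 h2
    have h3 := neg_abs_le (F r₂)
    have h4 := le_abs_self (F r₂)
    have h5 : 0 ≤ K * α * r₂ ^ 2 := by positivity
    rw [abs_le]; constructor <;> linarith
  -- the linear comparison
  obtain ⟨B, hB⟩ : ∃ B, B = |β / α| := ⟨_, rfl⟩
  have hBnn : 0 ≤ B := by rw [hB]; positivity
  obtain ⟨C, hC, hCb⟩ := aux_lin α hα r₂ hr₂pos (fun r => (u r + β / α) ^ 2)
    (fun r => 2 * (u r + β / α) * u' r) (2 * (1 + B) * D) (by positivity)
    (fun r hr => by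
      refine HasDerivWithinAt.congr_deriv (((hud r hr).add_const (β / α)).pow 2) ?_
      norm_num)
    (fun r hr => by
      have hupos := hupos2 r hr
      have hr0 := hrpos r (hsub20 hr)
      have h1 := (hU r (hsub2 hr)).2.1
      have e : 2 * (u r + β / α) * u' r - 2 * α * r * (u r + β / α) ^ 2 =
          2 * ((u r + β / α) * (u' r - r * (α * u r + β))) := by
        have e : α * (β / α) = β := by field_simp
        linear_combination (- 2 * r * (u r + β / α)) * e
      have q1 : |u r + β / α| ≤ (1 + B) * u r := by
        have := abs_add_le (u r) (β / α)
        rw [← hB, abs_of_pos hupos] at this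
        nlinarith
      have q2 : |u' r - r * (α * u r + β)| ≤ D * (r / u r) := by
        have w1 := hh r hr
        have w2 := hg r (hsub20 hr)
        have w3 := (abs_le.1 (hφb _ (hU r (hsub2 hr)).1)).2
        have w4 : r * (φ' (u r) - α * u r - β) ≤ r * (K / u r) := by gcongr
        have w5 : r * (K / u r) ≤ D * (r / u r) := by
          have : r * (K / u r) = K * (r / u r) := by ring
          rw [this]; gcongr
        rw [abs_le]; constructor <;> linarith
      rw [e, abs_mul, abs_mul, abs_two]
      calc _ ≤ 2 * (((1 + B) * u r) * (D * (r / u r))) := by gcongr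
        _ = _ := by field_simp)
    (fun X => by
      obtain ⟨R, hR, hRu⟩ := hulim (|X| + 1 + B)
      refine ⟨max R r₂, mem_Ici.2 (le_max_right _ _), ?_⟩
      have h1 := hRu (max R r₂) (le_max_left _ _)
      have h2 := neg_abs_le (β / α)
      rw [← hB] at h2
      have h3 : |X| + 1 ≤ u (max R r₂) + β / α := by linarith
      have h4 := le_abs_self X
      have h5 := abs_nonneg X
      nlinarith)
  obtain ⟨N, hN⟩ : ∃ N, N = 2 * (1 + B) * D / (2 * α) := ⟨_, rfl⟩
  have hNpos : 0 < N := by rw [hN]; positivity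
  refine ⟨α / 2 * C, K * α + |F r₂| + α / 2 * N, r₂, by positivity, by positivity, hsub20 self_mem_Ici, ?_⟩
  intro r hr
  have h1 := hFbound r hr
  have h2 := hCb r hr
  rw [← hN] at h2
  have e : φ (u r) - α / 2 * C * Real.exp (α * r ^ 2) =
      F r + α / 2 * ((u r + β / α) ^ 2 - C * Real.exp (α * r ^ 2)) := by rw [hF]; ring
  have h3 : |α / 2 * ((u r + β / α) ^ 2 - C * Real.exp (α * r ^ 2))| ≤ α / 2 * N := by
    rw [abs_mul, abs_of_pos (by positivity : 0 < α / 2)]; gcongr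
  have h4 := abs_add_le (F r) (α / 2 * ((u r + β / α) ^ 2 - C * Real.exp (α * r ^ 2)))
  have hr2 : 1 ≤ r ^ 2 := one_le_pow₀ (hr₂3.trans hr)
  have h5 : |F r₂| * 1 ≤ |F r₂| * r ^ 2 := by gcongr
  have h6 : α / 2 * N * 1 ≤ α / 2 * N * r ^ 2 := by gcongr
  rw [e]
  linarith
end
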